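/- Suppose x₁, x₂ ∈ ℝ with 0 < |x_a| < 1 (a = 1,2) and x₁ ≠ x₂, and suppose there are g₁, g₂ ∈ ℕ and nonzero integers q₁, q₂ with q_a·x_a > 0 such that s_a = 2(1−g_a)/q_a (a = 1,2). Suppose reals s, s₁, s₂ together with x₁, x₂ satisfy (E1) and (E2), and that s₁ + s₂ = 0. Then either x₁ + x₂ = 0 and s = (1 − x₁² + 2s₁x₁)/(3 − x₁²), or s = 1 and one of the following holds: (s₁ = 2, s₂ = −2 and x₁ = x₂ + 1) or (s₂ = 2, s₁ = −2 and x₂ = x₁ + 1). -/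

import Mathlib

/-- If `a > 0` has the form `2(1-g)/q` with `q > 0`, then `a = 2` or `a ≤ 1`. -/
theorem aux_int (a : ℝ) (g : ℕ) (q : ℤ) (hq : 0 < q) (ha : 0 < a)
    (h : a * (q : ℝ) = 2 * (1 - (g : ℝ))) : a = 2 ∨ a ≤ 1 := by
  have hqr : (0 : ℝ) < q := by exact_mod_cast hq
  have hg : g = 0 := by
    by_contra hg
    have : (1 : ℝ) ≤ g := by exact_mod_cast Nat.one_le_iff_ne_zero.mpr hg
    have := mul_pos ha hqr
    linarith
  subst hg
  rcases (show q = 1 ∨ 2 ≤ q by omega) with h1 | h1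
  · left
    subst h1
    simpa using h
  · right
    have h2 : (2 : ℝ) ≤ q := by exact_mod_cast h1
    push_cast at h
    nlinarith

theorem aux_main (x y a : ℝ) (hx : |x| < 1) (hy : |y| < 1) (hx0 : x ≠ 0)
    (g₁ g₂ : ℕ) (q₁ q₂ : ℤ)
    (hqx₁ : 0 < (q₁ : ℝ) * x) (hqx₂ : 0 < (q₂ : ℝ) * y)
    (e₁ : a * (q₁ : ℝ) = 2 * (1 - (g₁ : ℝ)))
    (e₂ : -a * (q₂ : ℝ) = 2 * (1 - (g₂ : ℝ)))
    (ha : 0 < a) (hd : a * (x - y) = 2) : a = 2 ∧ x = y + 1 := by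
  rw [abs_lt] at hx hy
  have key : a = 2 ∨ a ≤ 1 := by
    rcases lt_or_gt_of_ne hx0 with hn | hp
    · have hyn : y < 0 := by nlinarith
      have hq : (q₂ : ℝ) < 0 := by
        by_contra hc
        push Not at hc
        nlinarith
      have hq' : q₂ < 0 := by exact_mod_cast hq
      refine aux_int a g₂ (-q₂) (by omega) ha ?_
      push_cast
      linarith
    · have hq : (0 : ℝ) < q₁ := pos_of_mul_pos_left hqx₁ hp.le
      exact aux_int a g₁ q₁ (by exact_mod_cast hq) ha e₁
  rcases key with h | h
  · subst h
    exact ⟨rfl, by linarith⟩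
  · exfalso
    nlinarith

/-- classification of solutions of (E1)–(E2) with `s₁ + s₂ = 0`,
under the integrality conditions `s_a = 2(1 - g_a)/q_a` with `q_a x_a > 0`. -/
theorem stmt15 (x₁ x₂ s s₁ s₂ : ℝ)
    (h₁ : 0 < |x₁|) (h₁' : |x₁| < 1) (h₂ : 0 < |x₂|) (h₂' : |x₂| < 1)
    (hne : x₁ ≠ x₂)
    (g₁ g₂ : ℕ) (q₁ q₂ : ℤ) (hq₁ : q₁ ≠ 0) (hq₂ : q₂ ≠ 0)
    (hqx₁ : 0 < (q₁ : ℝ) * x₁) (hqx₂ : 0 < (q₂ : ℝ) * x₂)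
    (hs₁ : s₁ = 2 * (1 - (g₁ : ℝ)) / (q₁ : ℝ))
    (hs₂ : s₂ = 2 * (1 - (g₂ : ℝ)) / (q₂ : ℝ))
    (hE1 : x₁ * (s₁ * (x₁ - x₂) - 2 + (1 - s) * x₁ * x₂) + 3 * (s - 1) * x₂ = 0)
    (hE2 : x₂ * (s₂ * (x₂ - x₁) - 2 + (1 - s) * x₁ * x₂) + 3 * (s - 1) * x₁ = 0)
    (hsum : s₁ + s₂ = 0) :
    (x₁ + x₂ = 0 ∧ s = (1 - x₁ ^ 2 + 2 * s₁ * x₁) / (3 - x₁ ^ 2)) ∨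
    (s = 1 ∧ ((s₁ = 2 ∧ s₂ = -2 ∧ x₁ = x₂ + 1) ∨ (s₂ = 2 ∧ s₁ = -2 ∧ x₂ = x₁ + 1))) := by
  have hx0 : x₁ ≠ 0 := abs_pos.mp h₁
  have hy0 : x₂ ≠ 0 := abs_pos.mp h₂
  have hs : s₂ = -s₁ := by linarith
  have e₁ : s₁ * (q₁ : ℝ) = 2 * (1 - (g₁ : ℝ)) := by
    rw [hs₁, div_mul_cancel₀ _ (by exact_mod_cast hq₁)]
  have e₂ : s₂ * (q₂ : ℝ) = 2 * (1 - (g₂ : ℝ)) := by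
    rw [hs₂, div_mul_cancel₀ _ (by exact_mod_cast hq₂)]
  clear hs₁ hs₂ hsum
  subst hs
  have hk : (s - 1) * ((x₁ - x₂) * (x₁ + x₂)) = 0 := by
    linear_combination (x₁ * hE2 - x₂ * hE1) / 3
  have hd0 : x₁ - x₂ ≠ 0 := sub_ne_zero.mpr hne
  rcases mul_eq_zero.mp hk with h | h
  · right
    have hs1 : s = 1 := by linarith
    subst hs1
    refine ⟨rfl, ?_⟩
    have hd : s₁ * (x₁ - x₂) = 2 := by
      apply mul_left_cancel₀ hx0
      linear_combination hE1
    have hs0 : s₁ ≠ 0 := by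
      rintro rfl
      norm_num at hd
    rcases lt_or_gt_of_ne hs0 with hn | hp
    · right
      obtain ⟨ha, hb⟩ := aux_main x₂ x₁ (-s₁) h₂' h₁' hy0 g₂ g₁ q₂ q₁ hqx₂ hqx₁ e₂
        (by linarith) (by linarith) (by linarith)
      exact ⟨ha, by linarith, hb⟩
    · left
      obtain ⟨ha, hb⟩ := aux_main x₁ x₂ s₁ h₁' h₂' hx0 g₁ g₂ q₁ q₂ hqx₁ hqx₂ e₁ e₂ hp hd
      exact ⟨ha, by linarith, hb⟩
  · left
    have h0 : x₁ + x₂ = 0 := (mul_eq_zero.mp h).resolve_left hd0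
    refine ⟨h0, ?_⟩
    have hy : x₂ = -x₁ := by linarith
    subst hy
    rw [abs_lt] at h₁'
    have hpos : 3 - x₁ ^ 2 ≠ 0 := by nlinarith
    rw [eq_div_iff hpos]
    apply mul_left_cancel₀ hx0
    linear_combination -hE1
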